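/- arXiv:1701.06325 — 3 statements merged into one kernel-verified Lean document; each statement's English description precedes it below -/
import Mathlib

section
/- Let N, n ≥ 1, let L be an N×N complex matrix and let A₀ and M₀ be n×n complex matrices. Then every eigenvalue of the (Nn)×(Nn) matrix I_N ⊗ A₀ + L ⊗ M₀ (Kronecker products) has negative real part if and only if for every eigenvalue λ of L, every eigenvalue of A₀ + λ·M₀ has negative real part. (This is the content of the paper's Theorem 1: the formation controller stabilizes the closed-loop formation dynamics A + BKL if and only if it simultaneously stabilizes the N individual subsystems A_i + λ_i B_i K_i, where λ_i ranges over the eigenvalues of the graph Laplacian.) -/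
open Matrix Kronecker

namespace Matrix

/-- The spectrum of a matrix over a field consists of the scalars having an eigenvector. -/
theorem mem_spectrum_iff_exists_mulVec_eq_smul {K ι : Type*} [Field K] [Fintype ι]
    [DecidableEq ι] (A : Matrix ι ι K) (μ : K) :
    μ ∈ spectrum K A ↔ ∃ v : ι → K, v ≠ 0 ∧ A *ᵥ v = μ • v := by
  rw [← Matrix.spectrum_toLin', ← Module.End.hasEigenvalue_iff_mem_spectrum]
  constructor
  · intro h
    obtain ⟨v, hv⟩ := h.exists_hasEigenvector
    exact ⟨v, hv.2, by simpa using hv.apply_eq_smul⟩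
  · rintro ⟨v, h0, hv⟩
    exact Module.End.hasEigenvalue_of_hasEigenvector
      ⟨Module.End.mem_eigenspace_iff.2 (by simpa using hv), h0⟩

theorem mem_spectrum_of_mul_eq_smul {K ι κ : Type*} [Field K] [Fintype ι]
    [DecidableEq ι] {A : Matrix ι ι K} {X : Matrix ι κ K} {μ : K} (hX : X ≠ 0)
    (h : A * X = μ • X) : μ ∈ spectrum K A := by
  obtain ⟨j, hj⟩ : ∃ j, X.col j ≠ 0 := by
    by_contra! H
    exact hX (Matrix.ext fun i j => congrFun (H j) i)
  exact (mem_spectrum_iff_exists_mulVec_eq_smul A μ).2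
    ⟨X.col j, hj, funext fun i => congrFun (congrFun h i) j⟩

/-- Eigenvectors of `1 ⊗ A + L ⊗ M`, viewed as matrices. -/
theorem mem_spectrum_one_kronecker_add_kronecker_iff {K ι κ : Type*} [Field K]
    [Fintype ι] [DecidableEq ι] [Fintype κ] [DecidableEq κ]
    (L : Matrix ι ι K) (A M : Matrix κ κ K) (μ : K) :
    μ ∈ spectrum K ((1 : Matrix ι ι K) ⊗ₖ A + L ⊗ₖ M) ↔
      ∃ X : Matrix κ ι K, X ≠ 0 ∧ A * X + M * X * Lᵀ = μ • X := by
  have key (X : Matrix κ ι K) :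
      ((1 : Matrix ι ι K) ⊗ₖ A + L ⊗ₖ M) *ᵥ vec X = vec (A * X + M * X * Lᵀ) := by
    simp [add_mulVec, kronecker_mulVec_vec]
  rw [mem_spectrum_iff_exists_mulVec_eq_smul]
  constructor
  · rintro ⟨v, h0, hv⟩
    obtain ⟨X, rfl⟩ := vec_bijective.surjective v
    refine ⟨X, fun h => h0 (by simp [h]), ?_⟩
    rw [key, ← vec_smul] at hv
    exact vec_bijective.injective hv
  · rintro ⟨X, h0, hX⟩
    exact ⟨vec X, by simpa using h0, by rw [key, hX, vec_smul]⟩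

/-- Over an algebraically closed field, the spectrum of `1 ⊗ A + L ⊗ M` is the union of the
spectra of `A + l • M`, for `l` in the spectrum of `L`. -/
theorem mem_spectrum_one_kronecker_add_kronecker_iff_exists {K ι κ : Type*} [Field K]
    [IsAlgClosed K] [Fintype ι] [DecidableEq ι] [Fintype κ] [DecidableEq κ]
    (L : Matrix ι ι K) (A M : Matrix κ κ K) (μ : K) :
    μ ∈ spectrum K ((1 : Matrix ι ι K) ⊗ₖ A + L ⊗ₖ M) ↔
      ∃ l ∈ spectrum K L, μ ∈ spectrum K (A + l • M) := by
  rw [mem_spectrum_one_kronecker_add_kronecker_iff]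
  constructor
  · rintro ⟨X, h0, hX⟩
    let W : Submodule K (Matrix κ ι K) :=
      { carrier := {X | A * X + M * X * Lᵀ = μ • X}
        add_mem' := fun {X Y} hX hY => by
          simp only [Set.mem_ofPred_eq] at hX hY ⊢
          rw [smul_add, ← hX, ← hY]
          simp only [Matrix.mul_add, Matrix.add_mul]
          abel
        zero_mem' := by simp
        smul_mem' := fun c X hX => by
          simp only [Set.mem_ofPred_eq] at hX ⊢
          rw [smul_comm, ← hX]
          simp }
    let R : Module.End K W :=
      { toFun := fun Y => ⟨Y.1 * Lᵀ, by
          have hY : A * Y.1 + M * Y.1 * Lᵀ = μ • Y.1 := Y.2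
          change A * (Y.1 * Lᵀ) + M * (Y.1 * Lᵀ) * Lᵀ = μ • (Y.1 * Lᵀ)
          rw [← Matrix.smul_mul, ← hY]
          simp only [Matrix.add_mul, Matrix.mul_assoc]⟩
        map_add' := fun Y Z => Subtype.ext (Matrix.add_mul _ _ _)
        map_smul' := fun c Y => Subtype.ext (Matrix.smul_mul _ _ _) }
    have : Nontrivial W := ⟨⟨X, hX⟩, 0, fun h => h0 (congrArg Subtype.val h)⟩
    obtain ⟨l, hl⟩ := Module.End.exists_eigenvalue R
    obtain ⟨⟨Y, hY⟩, hYv⟩ := hl.exists_hasEigenvector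
    have hY0 : Y ≠ 0 := fun h => hYv.2 (Subtype.ext h)
    have hYl : Y * Lᵀ = l • Y := congrArg Subtype.val hYv.apply_eq_smul
    have hYμ : A * Y + M * Y * Lᵀ = μ • Y := hY
    refine ⟨l, mem_spectrum_of_mul_eq_smul (X := Yᵀ) (by simpa using hY0) ?_,
      mem_spectrum_of_mul_eq_smul hY0 ?_⟩
    · simpa using congrArg transpose hYl
    · rw [← hYμ, Matrix.mul_assoc, hYl, Matrix.add_mul, Matrix.smul_mul, Matrix.mul_smul]
  · rintro ⟨l, hl, hμ⟩
    obtain ⟨v, hv0, hv⟩ := (mem_spectrum_iff_exists_mulVec_eq_smul L l).1 hl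
    obtain ⟨w, hw0, hw⟩ := (mem_spectrum_iff_exists_mulVec_eq_smul _ μ).1 hμ
    obtain ⟨i, hi⟩ := Function.ne_iff.1 hv0
    obtain ⟨j, hj⟩ := Function.ne_iff.1 hw0
    refine ⟨vecMulVec w v, fun h => mul_ne_zero hj hi (congrFun (congrFun h j) i), ?_⟩
    rw [mul_vecMulVec, mul_vecMulVec, vecMulVec_mul, vecMul_transpose, hv, vecMulVec_smul,
      ← smul_vecMulVec, ← add_vecMulVec, ← smul_vecMulVec, ← hw, add_mulVec, smul_mulVec]

end Matrix

/-- Paper Theorem 1 (stability version): all eigenvalues of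
`I_N ⊗ A₀ + L ⊗ M₀` have negative real part iff for every eigenvalue `λ` of
`L`, all eigenvalues of `A₀ + λ • M₀` have negative real part. -/
theorem stmt_0 (N n : ℕ) (hN : 1 ≤ N) (hn : 1 ≤ n)
    (L : Matrix (Fin N) (Fin N) ℂ) (A₀ M₀ : Matrix (Fin n) (Fin n) ℂ) :
    (∀ μ ∈ spectrum ℂ ((1 : Matrix (Fin N) (Fin N) ℂ) ⊗ₖ A₀ + L ⊗ₖ M₀), μ.re < 0) ↔
      (∀ l ∈ spectrum ℂ L, ∀ μ ∈ spectrum ℂ (A₀ + l • M₀), μ.re < 0) := by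
  simp only [mem_spectrum_one_kronecker_add_kronecker_iff_exists]
  exact ⟨fun h l hl μ hμ => h μ ⟨l, hl, hμ⟩, fun h μ ⟨l, hl, hμ⟩ => h l hl μ hμ⟩
end

section
/- Let A be an n×n real matrix, B an n×m real matrix, C a p×n real matrix, E an n×q real matrix, and let H (n×p) and P₁ (n×p) be matrices satisfying (HC − I)E = 0. Define T = I − HC, F = A − HCA − P₁C, P₂ = FH and P = P₁ + P₂. Suppose x, z : ℝ → ℝⁿ are differentiable, u : ℝ → ℝᵐ and d : ℝ → ℝ^q are arbitrary functions, and for all t: x′(t) = A·x(t) + B·u(t) + E·d(t), y(t) = C·x(t), z′(t) = F·z(t) + T·B·u(t) + P·y(t), and x̂(t) = z(t) + H·y(t). Then the estimation error e(t) = x(t) − x̂(t) satisfies e′(t) = F·e(t) for all t, regardless of the unknown input d. -/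
open Matrix

/-- A constant matrix commutes with differentiation of a vector-valued function. -/
theorem HasDerivAt.const_mulVec {m n : Type*} [Fintype m] [Fintype n]
    (M : Matrix m n ℝ) {f : ℝ → n → ℝ} {f' : n → ℝ} {t : ℝ} (hf : HasDerivAt f f' t) :
    HasDerivAt (fun s => M.mulVec (f s)) (M.mulVec f') t :=
  M.mulVecLin.toContinuousLinearMap.hasFDerivAt.comp_hasDerivAt t hf

/-- UIO error dynamics (paper, Section III.A): with the matrix conditions
`(HC − I)E = 0`, `T = I − HC`, `F = A − HCA − P₁C`, `P₂ = FH`, `P = P₁ + P₂`,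
the estimation error `e = x − x̂` satisfies `e′ = F e`, regardless of the
unknown input `d`. -/
theorem stmt_6 (n m p q : ℕ)
    (A : Matrix (Fin n) (Fin n) ℝ) (B : Matrix (Fin n) (Fin m) ℝ)
    (C : Matrix (Fin p) (Fin n) ℝ) (E : Matrix (Fin n) (Fin q) ℝ)
    (H P₁ : Matrix (Fin n) (Fin p) ℝ)
    (hHE : (H * C - 1) * E = 0)
    (T F : Matrix (Fin n) (Fin n) ℝ) (P₂ P : Matrix (Fin n) (Fin p) ℝ)
    (hT : T = 1 - H * C)
    (hF : F = A - H * C * A - P₁ * C)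
    (hP₂ : P₂ = F * H)
    (hP : P = P₁ + P₂)
    (x z : ℝ → Fin n → ℝ) (u : ℝ → Fin m → ℝ) (d : ℝ → Fin q → ℝ)
    (y : ℝ → Fin p → ℝ) (xhat : ℝ → Fin n → ℝ)
    (hx : ∀ t, HasDerivAt x (A.mulVec (x t) + B.mulVec (u t) + E.mulVec (d t)) t)
    (hy : ∀ t, y t = C.mulVec (x t))
    (hz : ∀ t, HasDerivAt z (F.mulVec (z t) + (T * B).mulVec (u t) +
      P.mulVec (y t)) t)
    (hxhat : ∀ t, xhat t = z t + H.mulVec (y t)) :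
    ∀ t, HasDerivAt (fun s => x s - xhat s) (F.mulVec (x t - xhat t)) t := by
  intro t
  have hE : (H * C) * E = E := by
    rwa [Matrix.sub_mul, Matrix.one_mul, sub_eq_zero] at hHE
  have hFT : T * A - P * C = F * T := by
    rw [hP, hP₂, hT, Matrix.add_mul, Matrix.sub_mul, Matrix.one_mul, Matrix.mul_sub,
      Matrix.mul_one, Matrix.mul_assoc F]
    nth_rewrite 2 [hF]
    abel
  have hTE : T * E = 0 := by
    rw [hT, Matrix.sub_mul, Matrix.one_mul, hE, sub_self]
  have he : ∀ s, x s - xhat s = T.mulVec (x s) - z s := by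
    intro s
    rw [hxhat, hy, hT, Matrix.sub_mulVec, Matrix.one_mulVec, Matrix.mulVec_mulVec]
    abel
  have hderiv := ((hx t).const_mulVec T).sub (hz t)
  rw [funext he, he t]
  refine hderiv.congr_deriv ?_
  simp only [hy, Matrix.mulVec_add, Matrix.mulVec_sub, Matrix.mulVec_mulVec, hTE,
    Matrix.zero_mulVec, ← hFT, Matrix.sub_mulVec]
  abel
end

section
/- Let A be an n×n real matrix, B an n×m real matrix, C a p×n real matrix, E an n×q real matrix, and let H (n×p) and P₁ (n×p) be matrices satisfying (HC − I)E = 0. Define T = I − HC, F = A − HCA − P₁C, P₂ = FH and P = P₁ + P₂. Assume every complex root of the characteristic polynomial of F has negative real part. Suppose x, z : ℝ → ℝⁿ are differentiable, u : ℝ → ℝᵐ and d : ℝ → ℝ^q are arbitrary functions, and for all t: x′(t) = A·x(t) + B·u(t) + E·d(t), y(t) = C·x(t), z′(t) = F·z(t) + T·B·u(t) + P·y(t), and x̂(t) = z(t) + H·y(t). Then the estimation error e(t) = x(t) − x̂(t) tends to 0 as t → ∞, regardless of the unknown input d. -/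
open Matrix Filter

/-- A linear equation `f' = c f + g` with `Re c < 0` and vanishing forcing term `g` has
only solutions that tend to zero. -/
theorem tendsto_zero_of_hasDerivAt_smul_add {V : Type*} [NormedAddCommGroup V]
    [NormedSpace ℂ V] [NormedSpace ℝ V] [IsScalarTower ℝ ℂ V] {c : ℂ} (hc : c.re < 0)
    {f g : ℝ → V} (hf : ∀ t, HasDerivAt f (c • f t + g t) t)
    (hg : Tendsto g atTop (nhds 0)) : Tendsto f atTop (nhds 0) := by
  have hexp : ∀ t : ℝ, HasDerivAt (fun t : ℝ => Complex.exp (-c * t))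
      (Complex.exp (-c * t) * (-c)) t := fun t => by
    simpa using ((Complex.ofRealCLM.hasDerivAt (x := t)).const_mul (-c)).cexp
  have hderiv : ∀ t : ℝ, HasDerivAt (fun t : ℝ => Complex.exp (-c * t) • f t)
      (Complex.exp (-c * t) • g t) t := fun t => by
    refine ((hexp t).smul (hf t)).congr_deriv ?_
    rw [smul_add, smul_smul, mul_neg, neg_smul]
    abel
  have hnorm : ∀ t : ℝ, ‖Complex.exp (-c * t)‖ = Real.exp (-c.re * t) := fun t => by
    simp [Complex.norm_exp]
  have ha : 0 < -c.re := neg_pos.2 hc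
  rw [NormedAddGroup.tendsto_nhds_zero]
  intro ε hε
  obtain ⟨t₀, ht₀⟩ := eventually_atTop.1
    (NormedAddGroup.tendsto_nhds_zero.1 hg (-c.re * (ε / 2)) (by positivity))
  set K := ‖Complex.exp (-c * t₀) • f t₀‖
  have hbound : ∀ t, t₀ ≤ t →
      ‖Complex.exp (-c * t) • f t‖ ≤ K + ε / 2 * Real.exp (-c.re * t) := by
    intro t ht
    refine image_norm_le_of_norm_deriv_right_le_deriv_boundary
      (a := t₀) (b := t) (f' := fun s : ℝ => Complex.exp (-c * s) • g s)
      (B := fun s => K + ε / 2 * Real.exp (-c.re * s))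
      (B' := fun s => ε / 2 * (Real.exp (-c.re * s) * -c.re))
      (fun s _ => (hderiv s).continuousAt.continuousWithinAt)
      (fun s _ => (hderiv s).hasDerivWithinAt) ?_ ?_ ?_ ⟨ht, le_rfl⟩
    · exact le_add_of_nonneg_right (by positivity)
    · intro s
      simpa using (((hasDerivAt_id s).const_mul (-c.re)).exp.const_mul (ε / 2)).const_add K
    · intro s hs
      rw [norm_smul, hnorm]
      calc Real.exp (-c.re * s) * ‖g s‖ ≤ Real.exp (-c.re * s) * (-c.re * (ε / 2)) := by
            gcongr
            exact (ht₀ s hs.1).le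
        _ = ε / 2 * (Real.exp (-c.re * s) * -c.re) := by ring
  have hdecay : Tendsto (fun t => K * Real.exp (-(-c.re * t))) atTop (nhds 0) := by
    simpa using (Real.tendsto_exp_neg_atTop_nhds_zero.comp
      (tendsto_id.const_mul_atTop ha)).const_mul K
  filter_upwards [hdecay.eventually_lt_const (half_pos hε), eventually_ge_atTop t₀]
    with t hKt ht
  have hpos := Real.exp_pos (-c.re * t)
  have h := hbound t ht
  rw [norm_smul, hnorm] at h
  rw [Real.exp_neg, ← div_eq_mul_inv, div_lt_iff₀ hpos] at hKt
  refine lt_of_mul_lt_mul_left ?_ hpos.le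
  linarith

/-- A solution of `f' = M f` annihilated by a product of factors `M - c` with `Re c < 0`
tends to zero. -/
theorem tendsto_zero_of_aeval_prod_mulVec_eq_zero {ι : Type*} [Fintype ι] [DecidableEq ι]
    (M : Matrix ι ι ℂ) (s : Multiset ℂ) (hs : ∀ c ∈ s, c.re < 0) (f : ℝ → ι → ℂ)
    (hf : ∀ t, HasDerivAt f (M *ᵥ f t) t)
    (h : ∀ t,
      Polynomial.aeval M (s.map fun c => Polynomial.X - Polynomial.C c).prod *ᵥ f t = 0) :
    Tendsto f atTop (nhds 0) := by
  induction s using Multiset.induction_on generalizing f with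
  | empty =>
    have hzero : f = 0 := funext fun t => by simpa using h t
    rw [hzero]
    exact tendsto_const_nhds
  | cons c s ih =>
    set N := M - algebraMap ℂ (Matrix ι ι ℂ) c with hN
    have hcomm : N * M = M * N :=
      ((Commute.refl M).sub_left (Algebra.commutes c M)).eq
    have hsplit : ∀ t, M *ᵥ f t = c • f t + N *ᵥ f t := fun t => by
      rw [hN, sub_mulVec, Algebra.algebraMap_eq_smul_one, smul_mulVec, one_mulVec]
      abel
    refine tendsto_zero_of_hasDerivAt_smul_add (hs c (Multiset.mem_cons_self c s))
      (g := fun t => N *ᵥ f t) (fun t => hsplit t ▸ hf t) ?_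
    refine ih (fun b hb => hs b (Multiset.mem_cons_of_mem hb)) _ (fun t => ?_) fun t => ?_
    · have := (N.mulVecLin.toContinuousLinearMap.restrictScalars ℝ).hasFDerivAt.comp_hasDerivAt
        t (hf t)
      rw [mulVec_mulVec, ← hcomm, ← mulVec_mulVec]
      exact this
    · have := h t
      rw [Multiset.map_cons, Multiset.prod_cons, mul_comm, map_mul, ← mulVec_mulVec] at this
      simpa [hN] using this

/-- Every solution of `f' = M f` tends to zero when `M` is a real Hurwitz matrix. -/
theorem tendsto_zero_of_hurwitz {ι : Type*} [Fintype ι] [DecidableEq ι] (M : Matrix ι ι ℝ)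
    (hM : ∀ μ ∈ (M.map Complex.ofReal).charpoly.roots, μ.re < 0) (f : ℝ → ι → ℝ)
    (hf : ∀ t, HasDerivAt f (M *ᵥ f t) t) : Tendsto f atTop (nhds 0) := by
  have hcomplex : Tendsto (fun t i => (f t i : ℂ)) atTop (nhds 0) := by
    refine tendsto_zero_of_aeval_prod_mulVec_eq_zero (M.map Complex.ofReal) _ hM _
      (fun t => ?_) fun t => ?_
    · refine hasDerivAt_pi.2 fun i => (hasDerivAt_pi.1 (hf t) i).ofReal_comp.congr_deriv ?_
      simp [mulVec, dotProduct]
    · rw [← (IsAlgClosed.splits _).eq_prod_roots_of_monic (charpoly_monic _),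
        aeval_self_charpoly, zero_mulVec]
  refine tendsto_pi_nhds.2 fun i => ?_
  simpa [Function.comp_def] using
    (Complex.continuous_re.tendsto _).comp (tendsto_pi_nhds.1 hcomplex i)

/-- Defining property of a UIO (paper, Section III.A): with the matrix
conditions `(HC − I)E = 0`, `T = I − HC`, `F = A − HCA − P₁C`, `P₂ = FH`,
`P = P₁ + P₂`, and `F` Hurwitz, the estimation error `e = x − x̂` tends to `0`
as `t → ∞`, regardless of the unknown input `d`. -/
theorem stmt_7 (n m p q : ℕ)
    (A : Matrix (Fin n) (Fin n) ℝ) (B : Matrix (Fin n) (Fin m) ℝ)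
    (C : Matrix (Fin p) (Fin n) ℝ) (E : Matrix (Fin n) (Fin q) ℝ)
    (H P₁ : Matrix (Fin n) (Fin p) ℝ)
    (hHE : (H * C - 1) * E = 0)
    (T F : Matrix (Fin n) (Fin n) ℝ) (P₂ P : Matrix (Fin n) (Fin p) ℝ)
    (hT : T = 1 - H * C)
    (hF : F = A - H * C * A - P₁ * C)
    (hP₂ : P₂ = F * H)
    (hP : P = P₁ + P₂)
    (hHurwitz : ∀ μ ∈ ((F.map (Complex.ofReal)).charpoly).roots, μ.re < 0)
    (x z : ℝ → Fin n → ℝ) (u : ℝ → Fin m → ℝ) (d : ℝ → Fin q → ℝ)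
    (y : ℝ → Fin p → ℝ) (xhat : ℝ → Fin n → ℝ)
    (hx : ∀ t, HasDerivAt x (A.mulVec (x t) + B.mulVec (u t) + E.mulVec (d t)) t)
    (hy : ∀ t, y t = C.mulVec (x t))
    (hz : ∀ t, HasDerivAt z (F.mulVec (z t) + (T * B).mulVec (u t) +
      P.mulVec (y t)) t)
    (hxhat : ∀ t, xhat t = z t + H.mulVec (y t)) :
    Tendsto (fun t => x t - xhat t) atTop (nhds 0) := by
  refine tendsto_zero_of_hurwitz F hHurwitz _ fun t => ?_
  have herr : (fun t => x t - xhat t) = fun t => T *ᵥ x t - z t := funext fun t => by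
    rw [hxhat, hy, hT, sub_mulVec, one_mulVec, mulVec_mulVec]
    abel
  have hTE : T * E = 0 := by
    rw [hT, ← neg_sub, Matrix.neg_mul, hHE, neg_zero]
  have hTA : T * A = F + P₁ * C := by
    rw [hT, hF, Matrix.sub_mul, Matrix.one_mul]
    abel
  have hTx : HasDerivAt (fun t => T *ᵥ x t) _ t :=
    T.mulVecLin.toContinuousLinearMap.hasFDerivAt.comp_hasDerivAt t (hx t)
  rw [herr]
  refine (hTx.sub (hz t)).congr_deriv ?_
  change T *ᵥ (A *ᵥ x t + B *ᵥ u t + E *ᵥ d t) - _ = _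
  rw [hxhat, hy, hP, hP₂]
  simp only [mulVec_add, mulVec_sub, add_mulVec, mulVec_mulVec, hTE, hTA, zero_mulVec,
    Matrix.mul_assoc, Matrix.add_mul]
  abel
end
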